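/- Under the stated hypotheses, for every z ∈ S the limit lim_{t→∞} ∫_0^t ⟨∇φ(z), x(s) − z⟩ ds exists and is a real number. -/

import Mathlib

open Filter MeasureTheory Set RealInnerProductSpace

/-- A convex differentiable function lies above its tangent hyperplanes. -/
theorem ConvexOn.add_inner_gradient_le {H : Type*} [NormedAddCommGroup H]
    [InnerProductSpace ℝ H] [CompleteSpace H] {f : H → ℝ} (hf : ConvexOn ℝ univ f)
    {a : H} (hd : DifferentiableAt ℝ f a) (b : H) :
    f a + ⟪gradient f a, b - a⟫ ≤ f b := by
  have hconv : ConvexOn ℝ univ (f ∘ AffineMap.lineMap (k := ℝ) a b) := by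
    simpa using hf.comp_affineMap (AffineMap.lineMap (k := ℝ) a b)
  have hderiv : HasDerivAt (f ∘ AffineMap.lineMap (k := ℝ) a b) ⟪gradient f a, b - a⟫ 0 := by
    have h1 : HasFDerivAt f (InnerProductSpace.toDual ℝ H (gradient f a))
        (AffineMap.lineMap (k := ℝ) a b (0 : ℝ)) := by
      simpa using hd.hasGradientAt.hasFDerivAt
    simpa using h1.comp_hasDerivAt (0 : ℝ) AffineMap.hasDerivAt_lineMap
  have h := hconv.le_slope_of_hasDerivAt (mem_univ 0) (mem_univ 1) zero_lt_one hderiv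
  simp only [slope_def_field, Function.comp_apply, AffineMap.lineMap_apply_one,
    AffineMap.lineMap_apply_zero, sub_zero, div_one] at h
  linarith

/-- First-order optimality: at a minimizer over a convex set, the gradient has nonnegative
inner product with every feasible direction. -/
theorem IsMinOn.inner_gradient_nonneg {H : Type*} [NormedAddCommGroup H]
    [InnerProductSpace ℝ H] [CompleteSpace H] {f : H → ℝ} {s : Set H} {a b : H}
    (hmin : IsMinOn f s a) (hd : DifferentiableAt ℝ f a) (hs : Convex ℝ s)
    (ha : a ∈ s) (hb : b ∈ s) : 0 ≤ ⟪gradient f a, b - a⟫ := by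
  have h := hmin.localize.hasFDerivWithinAt_nonneg
    hd.hasGradientAt.hasFDerivAt.hasFDerivWithinAt
    (sub_mem_posTangentConeAt_of_segment_subset (hs.segment_subset ha hb))
  simpa using h

/-- If `h` is continuous, `h + g` is nonnegative with `g` integrable, and `W` is bounded below
with `W' ≤ -h`, then `h` is integrable on the half-line. -/
theorem integrableOn_Ioi_of_hasDerivWithinAt_le_neg {W W' h g : ℝ → ℝ} {m : ℝ}
    (hW : ∀ t ∈ Ici (0 : ℝ), HasDerivWithinAt W (W' t) (Ici 0) t)
    (hcont : ContinuousOn h (Ici 0)) (hg : IntegrableOn g (Ioi 0))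
    (hnn : ∀ t ∈ Ici (0 : ℝ), 0 ≤ h t + g t)
    (hle : ∀ t ∈ Ici (0 : ℝ), W' t ≤ -h t) (hm : ∀ t ∈ Ici (0 : ℝ), m ≤ W t) :
    IntegrableOn h (Ioi 0) := by
  have hsub : ∀ T : ℝ, Icc 0 T ⊆ Ici 0 := fun T t ht => ht.1
  have hint : ∀ T : ℝ, IntegrableOn h (Icc 0 T) := fun T =>
    (hcont.mono (hsub T)).integrableOn_Icc
  have hgoc : ∀ T : ℝ, IntegrableOn g (Ioc 0 T) := fun T => hg.mono_set fun t ht => ht.1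
  have hhg : IntegrableOn (fun t => h t + g t) (Ioi 0) := by
    refine integrableOn_Ioi_of_intervalIntegral_norm_bounded
      (W 0 - m + ∫ t in Ioi (0 : ℝ), |g t|) (b := id) (l := atTop) 0
      (fun T => ((hint T).mono_set Ioc_subset_Icc_self).add (hgoc T)) tendsto_id ?_
    filter_upwards [eventually_ge_atTop (0 : ℝ)] with T hT
    have hi : IntervalIntegrable h volume 0 T :=
      (intervalIntegrable_iff_integrableOn_Icc_of_le hT).2 (hint T)
    have gi : IntervalIntegrable g volume 0 T :=
      (intervalIntegrable_iff_integrableOn_Ioc_of_le hT).2 (hgoc T)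
    have e1 : ∫ t in (0 : ℝ)..T, ‖h t + g t‖ = (∫ t in (0 : ℝ)..T, h t) + ∫ t in (0 : ℝ)..T, g t := by
      rw [← intervalIntegral.integral_add hi gi]
      refine intervalIntegral.integral_congr fun t ht => ?_
      rw [uIcc_of_le hT] at ht
      exact Real.norm_of_nonneg (hnn t ht.1)
    have e2 := intervalIntegral.sub_le_integral_of_hasDeriv_right_of_le hT
      (fun t ht => ((hW t ht.1).mono (hsub T)).continuousWithinAt)
      (fun t ht => (hW t ht.1.le).mono fun r hr => ht.1.le.trans (le_of_lt hr))
      (hint T).neg (fun t ht => hle t ht.1.le)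
    have e3 : ∫ t in (0 : ℝ)..T, g t ≤ ∫ t in Ioi (0 : ℝ), |g t| := by
      rw [intervalIntegral.integral_of_le hT]
      calc ∫ t in Ioc 0 T, g t ≤ ∫ t in Ioc 0 T, |g t| :=
            integral_mono (hgoc T) (hgoc T).abs fun t => le_abs_self _
        _ ≤ _ := setIntegral_mono_set hg.abs (ae_of_all _ fun t => abs_nonneg _)
            (LE.le.eventuallyLE fun t ht => ht.1)
    simp only [Pi.neg_apply, intervalIntegral.integral_neg] at e2
    have := hm T hT
    simp only [id]
    rw [e1]
    linarith
  exact (hhg.sub hg).congr (ae_of_all _ fun t => by simp)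

theorem stmt5 {H : Type*} [NormedAddCommGroup H] [InnerProductSpace ℝ H] [CompleteSpace H]
    (φ ψ : H → ℝ) (γ k : ℝ) (β β' : ℝ → ℝ) (x x' x'' : ℝ → H)
    -- ψ is convex, Fréchet differentiable with Lipschitz continuous gradient,
    -- nonnegative, and argmin ψ = ψ⁻¹(0) is nonempty
    (hψconv : ConvexOn ℝ univ ψ)
    (hψdiff : Differentiable ℝ ψ)
    (hψlip : ∃ L : NNReal, LipschitzWith L (gradient ψ))
    (hψnonneg : ∀ y, 0 ≤ ψ y)
    (hψmin : ∃ y, ψ y = 0)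
    -- φ is convex, Fréchet differentiable with Lipschitz continuous gradient,
    -- bounded from below, and S = {z ∈ argmin ψ : φ z ≤ φ y ∀ y ∈ argmin ψ} is nonempty
    (hφconv : ConvexOn ℝ univ φ)
    (hφdiff : Differentiable ℝ φ)
    (hφlip : ∃ L : NNReal, LipschitzWith L (gradient φ))
    (hφbdd : BddBelow (range φ))
    (hS : ∃ z : H, ψ z = 0 ∧ ∀ y, ψ y = 0 → φ z ≤ φ y)
    -- γ > 0, 0 ≤ k < γ, and β : [0,∞) → (0,∞) is a C¹ function (with derivative β')
    -- satisfying the growth condition 0 ≤ β' ≤ k β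
    (hγ : 0 < γ) (hk : 0 ≤ k) (hkγ : k < γ)
    (hβpos : ∀ t ∈ Ici (0 : ℝ), 0 < β t)
    (hβderiv : ∀ t ∈ Ici (0 : ℝ), HasDerivWithinAt β (β' t) (Ici 0) t)
    (hβ'cont : ContinuousOn β' (Ici 0))
    (hβgrowth : ∀ t ∈ Ici (0 : ℝ), 0 ≤ β' t ∧ β' t ≤ k * β t)
    -- condition (H): for every p in the range of the normal cone to argmin ψ (i.e.
    -- p ∈ N(z) for some z ∈ argmin ψ = ψ⁻¹(0)), the integral
    -- ∫_0^∞ β(t) [ψ*(p/β(t)) - σ(p/β(t))] dt is finite; here σ(p/β(t)) = ⟪p/β(t), z⟫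
    -- since p ∈ N(z), and β(t)[ψ*(q) - ⟪q, z⟫] = ⨆ w, β(t)((⟪q, w⟫ - ψ w) - ⟪q, z⟫) ≥ 0.
    (hH : ∀ z p : H, ψ z = 0 → (∀ y, ψ y = 0 → ⟪p, y - z⟫ ≤ 0) →
      ∫⁻ t in Ici (0 : ℝ), ⨆ w : H,
        ENNReal.ofReal (β t * ((⟪(β t)⁻¹ • p, w⟫ - ψ w) - ⟪(β t)⁻¹ • p, z⟫)) ≠ ⊤)
    -- x : [0,∞) → H is twice continuously differentiable (first derivative x',
    -- second derivative x'') and satisfies ẍ + γ ẋ + ∇φ(x) + β ∇ψ(x) = 0 on [0,∞)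
    (hx' : ∀ t ∈ Ici (0 : ℝ), HasDerivWithinAt x (x' t) (Ici 0) t)
    (hx'' : ∀ t ∈ Ici (0 : ℝ), HasDerivWithinAt x' (x'' t) (Ici 0) t)
    (hx''cont : ContinuousOn x'' (Ici 0))
    (hode : ∀ t ∈ Ici (0 : ℝ),
      x'' t + γ • x' t + gradient φ (x t) + β t • gradient ψ (x t) = 0) :
    ∀ z : H, (ψ z = 0 ∧ ∀ y, ψ y = 0 → φ z ≤ φ y) →
      ∃ L : ℝ, Tendsto (fun T => ∫ s in (0:ℝ)..T, ⟪gradient φ z, x s - z⟫) atTop (nhds L) := by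
  rintro z ⟨hz, hzmin⟩
  obtain ⟨m, hm⟩ := hφbdd
  obtain ⟨l, hkl, hlγ⟩ := exists_between hkγ
  have hl : 0 < l := hk.trans_lt hkl
  have hkl' : 0 < l - k := sub_pos.2 hkl
  have hxc : ContinuousOn x (Ici 0) := fun t ht => (hx' t ht).continuousWithinAt
  have hβc : ContinuousOn β (Ici 0) := fun t ht => (hβderiv t ht).continuousWithinAt
  have hψx : ContinuousOn (fun t => ψ (x t)) (Ici 0) :=
    hψdiff.continuous.comp_continuousOn hxc
  set u : ℝ → ℝ := fun t => ⟪gradient φ z, x t - z⟫ with hu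
  set v : ℝ → ℝ := fun t => β t * ψ (x t) with hv
  have huc : ContinuousOn u (Ici 0) :=
    continuousOn_const.inner (hxc.sub continuousOn_const)
  have hvc : ContinuousOn v (Ici 0) := hβc.mul hψx
  have hv0 : ∀ t ∈ Ici (0 : ℝ), 0 ≤ v t := fun t ht =>
    mul_nonneg (hβpos t ht).le (hψnonneg _)
  have hnormal : ∀ y, ψ y = 0 → 0 ≤ ⟪gradient φ z, y - z⟫ := by
    intro y hy
    have hset : Convex ℝ {y | ψ y = 0} := by
      convert hψconv.convex_le 0 using 1
      ext w
      simpa using (hψnonneg w).ge_iff_eq'.symm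
    exact IsMinOn.inner_gradient_nonneg (fun w hw => hzmin w hw) (hφdiff z) hset hz hy
  -- The Fenchel gap evaluated along the trajectory.
  set c : ℝ := 2 * l / (l - k) with hc
  have hc0 : 0 < c := by positivity
  have hcl : (l - k) * c = 2 * l := by rw [hc]; field_simp
  set g : ℝ → ℝ := fun t => max 0 (-c * u t - v t)
  have hgc : ContinuousOn g (Ici 0) :=
    continuousOn_const.sup ((continuousOn_const.mul huc).sub hvc)
  have hgint : IntegrableOn g (Ici 0) := by
    refine ⟨hgc.aestronglyMeasurable measurableSet_Ici, ?_⟩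
    rw [hasFiniteIntegral_iff_ofReal (ae_of_all _ fun t => le_max_left 0 (-c * u t - v t))]
    have hfin := hH z (-c • gradient φ z) hz fun y hy => by
      rw [inner_smul_left]
      have := mul_nonneg hc0.le (hnormal y hy)
      simp only [conj_trivial]
      linarith
    refine lt_of_le_of_lt (setLIntegral_mono' measurableSet_Ici fun t ht => ?_) hfin.lt_top
    refine le_trans (le_of_eq ?_) (le_iSup _ (x t))
    have hβ := (hβpos t ht).ne'
    have e : β t * ((⟪(β t)⁻¹ • -c • gradient φ z, x t⟫ - ψ (x t))
        - ⟪(β t)⁻¹ • -c • gradient φ z, z⟫) = -c * u t - v t := by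
      simp only [hu, hv, inner_smul_left, inner_sub_right, conj_trivial]
      field_simp
      ring
    rw [e]
    simp [ENNReal.ofReal_max]
  have hgioi : IntegrableOn (fun t => (l - k) / 2 * g t) (Ioi 0) :=
    (hgint.mono_set Ioi_subset_Ici_self).const_mul _
  have hlow : ∀ t, (l - k) / 2 * v t ≤ l * u t + (l - k) * v t + (l - k) / 2 * g t := by
    intro t
    have h1 : -c * u t - v t ≤ g t := le_max_right _ _
    have h2 := mul_le_mul_of_nonneg_left h1 hkl'.le
    have h3 : (l - k) * (-c * u t - v t) = -(2 * l) * u t - (l - k) * v t := by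
      rw [← hcl]; ring
    linarith
  have hcomb : ContinuousOn (fun t => l * u t + (l - k) * v t) (Ici 0) :=
    (continuousOn_const.mul huc).add (continuousOn_const.mul hvc)
  have hint : IntegrableOn (fun t => l * u t + (l - k) * v t) (Ioi 0) := by
    refine integrableOn_Ioi_of_hasDerivWithinAt_le_neg (m := m) (g := fun t => (l - k) / 2 * g t)
      (W := fun t => 1 / 2 * ⟪x' t, x' t⟫ + φ (x t) + β t * ψ (x t)
        + l * (⟪x' t, x t - z⟫ + γ / 2 * ⟪x t - z, x t - z⟫))
      (fun t ht => ?_) hcomb hgioi (fun t ht => ?_) (fun t ht => ?_) (fun t ht => ?_)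
      (W' := fun t => 1 / 2 * (⟪x' t, x'' t⟫ + ⟪x'' t, x' t⟫) + ⟪gradient φ (x t), x' t⟫
        + (β' t * ψ (x t) + β t * ⟪gradient ψ (x t), x' t⟫)
        + l * ((⟪x' t, x' t⟫ + ⟪x'' t, x t - z⟫)
          + γ / 2 * (⟪x t - z, x' t⟫ + ⟪x' t, x t - z⟫)))
    · have d1 := (hx'' t ht).inner ℝ (hx'' t ht)
      have d2 : HasDerivWithinAt (fun t => φ (x t)) ⟪gradient φ (x t), x' t⟫ (Ici 0) t :=
        (hφdiff (x t)).hasGradientAt.hasFDerivAt.comp_hasDerivWithinAt t (hx' t ht)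
      have d3 : HasDerivWithinAt (fun t => ψ (x t)) ⟪gradient ψ (x t), x' t⟫ (Ici 0) t :=
        (hψdiff (x t)).hasGradientAt.hasFDerivAt.comp_hasDerivWithinAt t (hx' t ht)
      have d4 := (hx' t ht).sub_const z
      have d5 := (hx'' t ht).inner ℝ d4
      have d6 := d4.inner ℝ d4
      exact (((d1.const_mul (1 / 2)).add d2).add ((hβderiv t ht).mul d3)).add
        ((d5.add (d6.const_mul (γ / 2))).const_mul l)
    · have := hlow t
      have := mul_nonneg hkl'.le (hv0 t ht)
      linarith
    · have hx''t : x'' t = -(γ • x' t + gradient φ (x t) + β t • gradient ψ (x t)) := by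
        rw [eq_neg_iff_add_eq_zero, ← hode t ht]; abel
      have hβt := hβpos t ht
      have i1 := hφconv.add_inner_gradient_le (hφdiff z) (x t)
      have i2 := hφconv.add_inner_gradient_le (hφdiff (x t)) z
      have i3 := hψconv.add_inner_gradient_le (hψdiff (x t)) z
      rw [hz] at i3
      have i4 := mul_le_mul_of_nonneg_right (hβgrowth t ht).2 (hψnonneg (x t))
      have i5 : 0 ≤ ⟪x' t, x' t⟫ := real_inner_self_nonneg
      have i6 := mul_nonneg (sub_pos.2 hlγ).le i5
      rw [← neg_sub (x t) z, inner_neg_right] at i2 i3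
      have i7 := mul_le_mul_of_nonneg_left i3 (mul_pos hl hβt).le
      have i8 := mul_le_mul_of_nonneg_left (add_le_add i1 i2) hl.le
      simp only [hu, hv]
      rw [hx''t]
      simp only [inner_neg_left, inner_neg_right, inner_add_left, inner_add_right,
        inner_smul_left, inner_smul_right, conj_trivial]
      rw [real_inner_comm (x' t) (x t - z), real_inner_comm (x' t) (gradient φ (x t)),
        real_inner_comm (x' t) (gradient ψ (x t))]
      linarith
    · have j1 : m ≤ φ (x t) := hm (mem_range_self _)
      have j2 : 0 ≤ β t * ψ (x t) := hv0 t ht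
      have j3 : 0 ≤ ⟪x' t + l • (x t - z), x' t + l • (x t - z)⟫ := real_inner_self_nonneg
      have j4 : 0 ≤ l * (γ - l) * ⟪x t - z, x t - z⟫ :=
        mul_nonneg (mul_pos hl (sub_pos.2 hlγ)).le real_inner_self_nonneg
      simp only [inner_add_left, inner_add_right, inner_smul_left, inner_smul_right,
        conj_trivial] at j3
      rw [real_inner_comm (x' t) (x t - z)] at j3
      linarith
  have hvint : IntegrableOn (fun t => (l - k) / 2 * v t) (Ioi 0) := by
    refine (hint.add hgioi).mono' (((continuousOn_const.mul hvc).mono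
      Ioi_subset_Ici_self).aestronglyMeasurable measurableSet_Ioi) ?_
    filter_upwards [ae_restrict_mem measurableSet_Ioi] with t ht
    rw [Real.norm_of_nonneg (mul_nonneg (half_pos hkl').le (hv0 t (Ioi_subset_Ici_self ht)))]
    exact hlow t
  have huint : IntegrableOn u (Ioi 0) := by
    have h := (hint.sub (hvint.const_mul 2)).const_mul l⁻¹
    refine h.congr (ae_of_all _ fun t => ?_)
    simp only [Pi.sub_apply]
    field_simp
    ring
  exact ⟨_, intervalIntegral_tendsto_integral_Ioi 0 huint tendsto_id⟩
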